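/- arXiv:2511.01003 — 5 statements merged into one kernel-verified Lean document; each statement's English description precedes it below -/
import Mathlib

section
/- There exists a positive integer n₀ such that for every integer n ≥ n₀, setting q = 2^n, and for all A, B, C, D, E ∈ 𝔽_{q²} such that neither condition (C1) nor condition (C2) holds, h₁ = 0 (where h₁ := A^{q+1} B^{q+1} + A B^{2q} + A^q B² + B² C^q D^q + B^{q+1} C^{q+1} + B^{q+1} D^{q+1} + B^{q+1} + B^{2q} C D), and B C^q + B^q D ≠ 0: if the Dillon hexanomial f_{A,B,C,D,E} is APN, then one of the following holds: (1) C^q = A^q B + A^q D + B^q, A^q B + B^q ≠ 0, and B^{q+1} + D^{q+1} + B D^q + B^q D + 1 = 0; or (2) E = 0. -/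
/-- A function `f : F → F` is almost perfect nonlinear (APN) if for every nonzero `a`
and every `b`, the equation `f (x + a) + f x = b` has at most two solutions. -/
def IsAPN {F : Type*} [Field F] (f : F → F) : Prop :=
  ∀ a b : F, a ≠ 0 → Set.ncard {x : F | f (x + a) + f x = b} ≤ 2

/-- The Dillon hexanomial `f_{A,B,C,D,E}(x) = A x³ + B x^{q+1} + C x^{2q+1} + D x^{q+2}
+ E x^{2q+2} + x^{3q}`. -/
def dillon {F : Type*} [Field F] (q : ℕ) (A B C D E : F) : F → F :=
  fun x => A * x ^ 3 + B * x ^ (q + 1) + C * x ^ (2 * q + 1) +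
    D * x ^ (q + 2) + E * x ^ (2 * q + 2) + x ^ (3 * q)

/-- Condition (C1): `A ≠ 0`, `C = D = 0`, `A^q B = B^q`, `A^q E = E^q`. -/
def CondC1 {F : Type*} [Field F] (q : ℕ) (A B C D E : F) : Prop :=
  A ≠ 0 ∧ C = 0 ∧ D = 0 ∧ A ^ q * B = B ^ q ∧ A ^ q * E = E ^ q

/-- Condition (C2): `A ≠ 0`, `C ≠ 0`, `D ≠ 0`, `A^{q+1} = 1`, `D = A C^q`,
`B^q = A^q B`, `E^q = A^q E`. -/
def CondC2 {F : Type*} [Field F] (q : ℕ) (A B C D E : F) : Prop :=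
  A ≠ 0 ∧ C ≠ 0 ∧ D ≠ 0 ∧ A ^ (q + 1) = 1 ∧ D = A * C ^ q ∧
    B ^ q = A ^ q * B ∧ E ^ q = A ^ q * E

/-- The key quantity `h₁` from the paper. -/
def h1Poly {F : Type*} [Field F] (q : ℕ) (A B C D : F) : F :=
  A ^ (q + 1) * B ^ (q + 1) + A * B ^ (2 * q) + A ^ q * B ^ 2 +
    B ^ 2 * C ^ q * D ^ q + B ^ (q + 1) * C ^ (q + 1) +
    B ^ (q + 1) * D ^ (q + 1) + B ^ (q + 1) + B ^ (2 * q) * C * D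

/-- The Artin–Schreier map `z ↦ z² + z` of a field of characteristic two. -/
def artinSchreier (k : Type*) [Field k] [CharP k 2] : k →+ k where
  toFun z := z ^ 2 + z
  map_zero' := by simp
  map_add' x y := by rw [CharTwo.add_sq]; ring

theorem exists_notMem_of_card_lt {α : Type*} [Finite α] (T : Finset α) (h : T.card < Nat.card α) :
    ∃ x, x ∉ T := by
  have := Fintype.ofFinite α
  by_contra! hT
  rw [Finset.eq_univ_iff_forall.2 hT, Finset.card_univ, Nat.card_eq_fintype_card] at h
  exact h.false

section FiniteFieldCharTwo

variable {k : Type*} [Field k] [Finite k] [CharP k 2]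

theorem index_range_artinSchreier : (artinSchreier k).range.index = 2 := by
  have hker : ((artinSchreier k).ker : Set k) = {0, 1} := by
    ext z
    have : z ^ 2 + z = z * (z - 1) + 2 * z := by ring
    simp [artinSchreier, AddMonoidHom.mem_ker, this, CharTwo.two_eq_zero, sub_eq_zero]
  have hcard : Nat.card (artinSchreier k).ker = 2 := by
    rw [← Set.ncard_pair (zero_ne_one (α := k)), ← hker]
    rfl
  have h1 := (artinSchreier k).ker.card_mul_index
  have h2 := (artinSchreier k).range.card_mul_index
  rw [AddSubgroup.index_ker, hcard] at h1
  have : 0 < Nat.card (artinSchreier k).range := Nat.card_pos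
  nlinarith

theorem exists_affine_mem_range_artinSchreier (κ d : k) (hκ : κ ≠ 0) (T : Finset k)
    (hT : 2 * T.card < Nat.card k) : ∃ v ∉ T, κ * v + d ∈ (artinSchreier k).range := by
  classical
  have := Fintype.ofFinite k
  let φ : k → k := fun z => (z ^ 2 + z - d) / κ
  have hfib : ∀ v ∈ Finset.univ.image φ, (Finset.univ.filter fun z => φ z = v).card ≤ 2 := by
    intro v hv
    obtain ⟨w, -, rfl⟩ := Finset.mem_image.1 hv
    refine (Finset.card_le_card (t := {w, w + 1}) fun z hz => ?_).trans Finset.card_le_two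
    have hz : z ^ 2 + z - d = w ^ 2 + w - d :=
      (div_left_inj' hκ).1 (Finset.mem_filter.1 hz).2
    have h0 : (z - w) * (z - (w + 1)) = 0 := by
      linear_combination hz - (z + z * w - w ^ 2 - w) * CharTwo.two_eq_zero (R := k)
    simpa [sub_eq_zero] using h0
  have hc := Finset.card_le_mul_card_image Finset.univ 2 hfib
  rw [Finset.card_univ, ← Nat.card_eq_fintype_card] at hc
  obtain ⟨v, hv, hvT⟩ := Finset.exists_mem_notMem_of_card_lt_card
    (show T.card < (Finset.univ.image φ).card by omega)
  obtain ⟨z, -, rfl⟩ := Finset.mem_image.1 hv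
  refine ⟨_, hvT, z, ?_⟩
  simp only [φ, artinSchreier, AddMonoidHom.coe_mk, ZeroHom.coe_mk]
  field_simp
  ring

theorem exists_add_inv_mem_range_artinSchreier (hk : 64 ≤ Nat.card k) (b c τ : k) :
    ∃ x, x ≠ 0 ∧ x ≠ 1 ∧ x ≠ τ ∧ b * x + c / x + (b + c) ∈ (artinSchreier k).range := by
  classical
  have hadd := fun a b : k =>
    AddSubgroup.add_mem_iff_of_index_two (index_range_artinSchreier (k := k)) (a := a) (b := b)
  by_cases hc : c = 0
  · by_cases hb : b = 0
    · obtain ⟨x, hx⟩ := exists_notMem_of_card_lt ({0, 1, τ} : Finset k)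
        (Finset.card_le_three.trans_lt (by omega))
      simp only [Finset.mem_insert, Finset.mem_singleton, not_or] at hx
      exact ⟨x, hx.1, hx.2.1, hx.2.2, by simp [hb, hc]⟩
    · have := (Finset.card_le_three (a := (0 : k)) (b := 1) (c := τ))
      obtain ⟨x, hx, hmem⟩ := exists_affine_mem_range_artinSchreier b b hb {0, 1, τ} (by omega)
      simp only [Finset.mem_insert, Finset.mem_singleton, not_or] at hx
      exact ⟨x, hx.1, hx.2.1, hx.2.2, by simpa [hc] using hmem⟩
  by_contra! hno
  obtain ⟨s, hs0, hs1, hs2⟩ : ∃ s : k, s ≠ 0 ∧ 1 + s ≠ 0 ∧ s ^ 2 + s + 1 ≠ 0 := by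
    obtain ⟨s, hs⟩ : ∃ s : k, s ∉ ({0, 1} : Finset k) ∧ s ^ 3 ≠ 1 := by
      obtain ⟨s, hs⟩ := exists_notMem_of_card_lt
        ({0, 1} ∪ (Polynomial.nthRoots 3 (1 : k)).toFinset) (by
          have h1 := Finset.card_union_le ({0, 1} : Finset k)
            (Polynomial.nthRoots 3 (1 : k)).toFinset
          have h2 := Finset.card_le_two (a := (0 : k)) (b := 1)
          have h3 := (Multiset.toFinset_card_le _).trans (Polynomial.card_nthRoots 3 (1 : k))
          omega)
      simp only [Finset.mem_union, not_or, Multiset.mem_toFinset,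
        Polynomial.mem_nthRoots (show 0 < 3 by norm_num)] at hs
      exact ⟨s, hs⟩
    simp only [Finset.mem_insert, Finset.mem_singleton, not_or] at hs
    refine ⟨s, hs.1.1, fun h => hs.1.2 ?_, fun h => hs.2 ?_⟩
    · linear_combination h - CharTwo.two_eq_zero (R := k)
    · linear_combination (s - 1) * h
  let T : Finset k := {0, 1, τ⁻¹, s, s / τ, 1 + s, (1 + s) / τ}
  have hT : T.card ≤ 7 := (Finset.card_insert_le _ _).trans (Nat.succ_le_succ Finset.card_le_six)
  obtain ⟨v, hv, hmem⟩ := exists_affine_mem_range_artinSchreier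
    (c * (s ^ 2 + s + 1) / (s * (1 + s))) (b + c)
    (div_ne_zero (mul_ne_zero hc hs2) (mul_ne_zero hs0 hs1)) T (by omega)
  simp only [T, Finset.mem_insert, Finset.mem_singleton, not_or] at hv
  obtain ⟨hv0, hv1, hv2, hv3, hv4, hv5, hv6⟩ := hv
  have hgood : ∀ r : k, r ≠ 0 → v ≠ r → v ≠ r / τ →
      b * (r / v) + c / (r / v) + (b + c) ∉ (artinSchreier k).range := by
    intro r hr h1 h2
    refine hno _ (div_ne_zero hr hv0) (fun h => h1 ?_) (fun h => h2 ?_)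
    · rw [div_eq_one_iff_eq hv0] at h; exact h.symm
    · rw [← h]; field_simp
  have g1 := hgood 1 one_ne_zero hv1 (by simpa using hv2)
  have g2 := hgood s hs0 hv3 hv4
  have g3 := hgood (1 + s) hs1 hv5 hv6
  have g12 := (hadd _ _).2 (iff_of_false g1 g2)
  have g123 := mt (fun h => ((hadd _ _).1 h).1 g12) g3
  refine g123 ?_
  convert hmem using 1
  field_simp
  linear_combination (b * s * (1 + s) ^ 2 + (b + c) * v * s * (1 + s) + v ^ 2 * c * s) *
     CharTwo.two_eq_zero (R := k)

theorem exists_simple_poles_mem_range_artinSchreier (hk : 64 ≤ Nat.card k) (c₁ c₂ ρ τ : k)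
    (hρ : ρ ≠ 0) : ∃ l, l ≠ 0 ∧ l + ρ ≠ 0 ∧ l ≠ τ ∧
      c₁ / l + c₂ / (l + ρ) ∈ (artinSchreier k).range := by
  obtain ⟨x, hx0, hx1, hxτ, hmem⟩ :=
    exists_add_inv_mem_range_artinSchreier hk (c₂ / ρ) (c₁ / ρ) (τ / (τ + ρ))
  have h2 : (2 : k) = 0 := CharTwo.two_eq_zero
  have hx1' : x + 1 ≠ 0 := fun h => hx1 (by linear_combination h - h2)
  have hl : ρ * x / (x + 1) + ρ = ρ / (x + 1) := by
    field_simp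
    linear_combination x * h2
  refine ⟨ρ * x / (x + 1), by positivity, ?_, ?_, ?_⟩
  · rw [hl]; exact div_ne_zero hρ hx1'
  · rintro rfl
    apply hxτ
    rw [hl]; field_simp
  · rw [hl]
    convert hmem using 1
    field_simp
    ring

theorem exists_double_poles_mem_range_artinSchreier (hk : 64 ≤ Nat.card k)
    (p₁ p₂ p₃ p₄ ρ τ : k) (hρ : ρ ≠ 0) : ∃ l z, l ≠ 0 ∧ l + ρ ≠ 0 ∧ l ≠ τ ∧
      p₁ / l ^ 2 + p₂ / l + p₃ / (l + ρ) ^ 2 + p₄ / (l + ρ) = z ^ 2 + z := by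
  obtain ⟨r, rfl⟩ := (bijective_frobenius k 2).surjective p₁
  obtain ⟨s, rfl⟩ := (bijective_frobenius k 2).surjective p₃
  obtain ⟨l, hl, hlρ, hlτ, z, hz⟩ :=
    exists_simple_poles_mem_range_artinSchreier hk (r + p₂) (s + p₄) ρ τ hρ
  refine ⟨l, z + r / l + s / (l + ρ), hl, hlρ, hlτ, ?_⟩
  simp only [artinSchreier, AddMonoidHom.coe_mk, ZeroHom.coe_mk] at hz
  rw [frobenius_def, frobenius_def, ← div_pow, ← div_pow]
  linear_combination -hz - (z * (r / l) + z * (s / (l + ρ)) + r / l * (s / (l + ρ)) + r / l +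
    s / (l + ρ)) * CharTwo.two_eq_zero (R := k)

end FiniteFieldCharTwo

section Involution

variable {F : Type*} [Field F]

theorem exists_add_map_eq_one {σ : F →+* F} (hσ : ∀ x, σ (σ x) = x) {x : F} (hx : x + σ x ≠ 0) :
    ∃ ω, ω + σ ω = 1 := by
  refine ⟨x / (x + σ x), ?_⟩
  rw [map_div₀, map_add, hσ, add_comm (σ x), ← add_div, div_self hx]

theorem card_le_card_eqLocusField_sq [Finite F] [CharP F 2] {σ : F →+* F}
    (hσ : ∀ x, σ (σ x) = x) {ω : F} (hω : ω + σ ω = 1) :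
    Nat.card F ≤ Nat.card (σ.eqLocusField (RingHom.id F)) ^ 2 := by
  rw [sq, ← Nat.card_prod]
  refine Nat.card_le_card_of_injective
    (fun x => (⟨x + σ x, ?_⟩, ⟨ω * σ x + σ ω * x, ?_⟩)) fun x y h => ?_
  · simp [hσ, add_comm]
  · simp [hσ, add_comm]
  · simp only [Prod.mk.injEq, Subtype.mk.injEq] at h
    linear_combination (-x + y) * hω + ω * h.1 - h.2 +
      (x - y) * σ ω * CharTwo.two_eq_zero (R := F)

/-- The hypotheses say that the numerators of the poles of
`l ↦ t² (c₀ + l e) + t (c₁ + b / l)` do not degenerate. -/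
theorem exists_sq_add_self_eq [Finite F] [CharP F 2] {σ : F →+* F} (hσ : ∀ x, σ (σ x) = x)
    {ω : F} (hω : ω + σ ω = 1) (hk : 64 ≤ Nat.card (σ.eqLocusField (RingHom.id F)))
    {c₀ c₁ b e : F} (hc₀ : c₀ + σ c₀ + 1 ≠ 0) (hb : b + σ b ≠ 0) (he : e + σ e ≠ 0) :
    ∃ l y, l ≠ 0 ∧ σ l = l ∧ y + σ y ≠ 0 ∧
      y ^ 2 + y = (y + σ y) ^ 2 * (c₀ + l * e) + (y + σ y) * (c₁ + b / l) := by
  have h2 : (2 : F) = 0 := CharTwo.two_eq_zero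
  have hmem : ∀ x, x ∈ σ.eqLocusField (RingHom.id F) ↔ σ x = x := fun x => Iff.rfl
  obtain ⟨d₀, hd₀⟩ : ∃ d, d = c₀ + ω ^ 2 := ⟨_, rfl⟩
  obtain ⟨d₁, hd₁⟩ : ∃ d, d = c₁ + ω := ⟨_, rfl⟩
  obtain ⟨u, hu⟩ : ∃ u, u = d₀ + σ d₀ := ⟨_, rfl⟩
  obtain ⟨v, hv⟩ : ∃ v, v = d₁ + σ d₁ := ⟨_, rfl⟩
  obtain ⟨β, hβ⟩ : ∃ β, β = b + σ b := ⟨_, rfl⟩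
  obtain ⟨ε, hε⟩ : ∃ ε, ε = e + σ e := ⟨_, rfl⟩
  have hu0 : u ≠ 0 := by
    intro h0
    apply hc₀
    rw [hu, hd₀, map_add, map_pow] at h0
    linear_combination h0 - (ω + σ ω + 1) * hω + (ω * σ ω) * h2
  rw [← hβ] at hb
  rw [← hε] at he
  have hσu : σ u = u := by rw [hu, map_add, hσ, add_comm]
  have hσv : σ v = v := by rw [hv, map_add, hσ, add_comm]
  have hσβ : σ β = β := by rw [hβ, map_add, hσ, add_comm]
  have hσε : σ ε = ε := by rw [hε, map_add, hσ, add_comm]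
  have hu' : σ d₀ = d₀ + u := by linear_combination -hu - d₀ * h2
  have hv' : σ d₁ = d₁ + v := by linear_combination -hv - d₁ * h2
  have hβ' : σ b = b + β := by linear_combination -hβ - b * h2
  have hε' : σ e = e + ε := by linear_combination -hε - e * h2
  obtain ⟨ρ, hρ⟩ : ∃ ρ, ρ = u / ε := ⟨_, rfl⟩
  obtain ⟨t₀, ht₀⟩ : ∃ t, t = β / u := ⟨_, rfl⟩
  obtain ⟨t₁, ht₁⟩ : ∃ t, t = (β + v * ρ) / u := ⟨_, rfl⟩
  have hσρ : σ ρ = ρ := by rw [hρ, map_div₀, hσu, hσε]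
  have hσt₀ : σ t₀ = t₀ := by rw [ht₀, map_div₀, hσu, hσβ]
  have hσt₁ : σ t₁ = t₁ := by rw [ht₁, map_div₀, map_add, map_mul, hσu, hσβ, hσv, hσρ]
  have hρ0 : ρ ≠ 0 := hρ ▸ div_ne_zero hu0 he
  have hp₁ : σ (d₀ * t₀ ^ 2 + b * t₀) = d₀ * t₀ ^ 2 + b * t₀ := by
    simp only [map_add, map_mul, map_pow, hu', hβ', hσt₀]
    rw [ht₀]; field_simp
    linear_combination u * β * h2
  have hp₂ : σ (e * t₀ ^ 2 + d₁ * t₀ + b * t₁ / ρ) = e * t₀ ^ 2 + d₁ * t₀ + b * t₁ / ρ := by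
    simp only [map_add, map_mul, map_pow, map_div₀, hε', hβ', hv', hσt₀, hσt₁, hσρ]
    rw [ht₁, ht₀, hρ]; field_simp
    linear_combination (β ^ 2 * ε + v * β * u) * h2
  have hp₃ : σ (t₁ ^ 2 * d₀ + ρ * e * t₁ ^ 2) = t₁ ^ 2 * d₀ + ρ * e * t₁ ^ 2 := by
    simp only [map_add, map_mul, map_pow, hε', hu', hσt₁, hσρ]
    rw [hρ]; field_simp
    linear_combination u * ε * t₁ ^ 2 * h2
  have hp₄ : σ (e * t₁ ^ 2 + d₁ * t₁ + b * t₁ / ρ) = e * t₁ ^ 2 + d₁ * t₁ + b * t₁ / ρ := by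
    simp only [map_add, map_mul, map_pow, map_div₀, hε', hβ', hv', hσt₁, hσρ]
    rw [ht₁, hρ]; field_simp
    linear_combination ε * (ε * β + v * u) ^ 2 * h2
  obtain ⟨⟨l, hl⟩, ⟨z, hz⟩, hl0, hlρ, hlτ, heq⟩ := exists_double_poles_mem_range_artinSchreier hk
    ⟨_, (hmem _).2 hp₁⟩ ⟨_, (hmem _).2 hp₂⟩ ⟨_, (hmem _).2 hp₃⟩ ⟨_, (hmem _).2 hp₄⟩
    ⟨ρ, (hmem _).2 hσρ⟩ ⟨β / v, (hmem _).2 (by rw [map_div₀, hσβ, hσv])⟩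
    (fun h => hρ0 (congrArg Subtype.val h))
  rw [hmem] at hl hz
  replace heq := congrArg Subtype.val heq
  simp only [Subfield.coe_add, Subfield.coe_div, SubmonoidClass.coe_pow] at heq
  replace hl0 : l ≠ 0 := fun h => hl0 (Subtype.ext h)
  replace hlρ : l + ρ ≠ 0 := fun h => hlρ (Subtype.ext h)
  replace hlτ : l ≠ β / v := fun h => hlτ (Subtype.ext h)
  obtain ⟨t, ht⟩ : ∃ t, t = t₀ / l + t₁ / (l + ρ) := ⟨_, rfl⟩
  have hσt : σ t = t := by
    rw [ht]; simp only [map_add, map_div₀, hσt₀, hσt₁, hl, hσρ]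
  have ht0 : t ≠ 0 := by
    intro h0
    have h1 : t * (l * (l + ρ) * u) = ρ * (β + v * l) := by
      rw [ht, ht₀, ht₁]; field_simp
      linear_combination l * β * h2
    rw [h0, zero_mul, eq_comm, mul_eq_zero, or_iff_right hρ0] at h1
    by_cases hv0 : v = 0
    · apply hb
      simpa [hv0] using h1
    · apply hlτ
      rw [eq_div_iff hv0]
      linear_combination h1 - β * h2
  have hy : ω * t + z + σ (ω * t + z) = t := by
    rw [map_add, map_mul, hσt, hz]
    linear_combination t * hω + z * h2
  refine ⟨l, ω * t + z, hl0, hl, by rwa [hy], ?_⟩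
  rw [hy]
  have key : t ^ 2 * (d₀ + l * e) + t * (d₁ + b / l) = z ^ 2 + z := by
    rw [← heq, ht]
    have : (t₀ / l + t₁ / (l + ρ)) ^ 2 * (d₀ + l * e) + (t₀ / l + t₁ / (l + ρ)) * (d₁ + b / l) =
        (d₀ * t₀ ^ 2 + b * t₀) / l ^ 2 + (e * t₀ ^ 2 + d₁ * t₀ + b * t₁ / ρ) / l +
        (t₁ ^ 2 * d₀ + ρ * e * t₁ ^ 2) / (l + ρ) ^ 2 +
        (e * t₁ ^ 2 + d₁ * t₁ + b * t₁ / ρ) / (l + ρ) +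
        2 * (t₀ * t₁ * (d₀ + l * e) / (l * (l + ρ)) - ρ * e * t₁ ^ 2 / (l + ρ) ^ 2 -
          b * t₁ / (ρ * (l + ρ))) := by
      field_simp
      ring
    rw [this, h2, zero_mul, add_zero]
  rw [hd₀, hd₁] at key
  linear_combination -key + (ω * t * z + ω^2*t^2 + ω * t) * h2

end Involution

section Dillon

variable {F : Type*} [Field F] {q : ℕ} {A B C D E : F}

theorem IsAPN.eq_zero_or_eq_self [Finite F] [CharP F 2] {f : F → F} (hf : IsAPN f)
    (hf0 : f 0 = 0) {a x : F} (ha : a ≠ 0) (h : f (x + a) + f x = f a) : x = 0 ∨ x = a := by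
  by_contra! hx
  have hsub : ({0, a, x} : Set F) ⊆ {x : F | f (x + a) + f x = f a} := by
    rintro y (rfl | rfl | rfl)
    · simp [hf0]
    · simp [hf0, CharTwo.add_self_eq_zero]
    · exact h
  have hcard := (Set.ncard_le_ncard hsub (Set.toFinite _)).trans (hf a (f a) ha)
  rw [Set.ncard_eq_three.2 ⟨0, a, x, ha.symm, hx.1.symm, hx.2.symm, rfl⟩] at hcard
  omega

theorem dillon_apply {σ : F →+* F} (hσ : ∀ x, σ x = x ^ q) (x : F) :
    dillon q A B C D E x = A * x ^ 3 + B * (x * σ x) + C * (x * σ x ^ 2) + D * (x ^ 2 * σ x) +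
      E * (x ^ 2 * σ x ^ 2) + σ x ^ 3 := by
  rw [dillon, hσ]
  ring

/-- The polarisation of the Dillon hexanomial at `a` has only the trivial zeros `0` and `a`. -/
theorem IsAPN.dillon_polarisation [Finite F] [CharP F 2] (hf : IsAPN (dillon q A B C D E))
    {σ : F →+* F} (hσ : ∀ x, σ x = x ^ q) {a y : F} (ha : a ≠ 0)
    (h : A * a ^ 3 * (y ^ 2 + y) + B * (a * σ a) * (y + σ y) + C * (a * σ a ^ 2) * (σ y ^ 2 + y) +
      D * (a ^ 2 * σ a) * (σ y + y ^ 2) + E * (a * σ a) ^ 2 * (y + σ y) ^ 2 +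
      σ a ^ 3 * (σ y ^ 2 + σ y) = 0) : y = 0 ∨ y = 1 := by
  have h0 : dillon q A B C D E 0 = 0 := by simp [dillon_apply hσ]
  have key : dillon q A B C D E (y * a + a) + dillon q A B C D E (y * a) =
      dillon q A B C D E a := by
    simp only [dillon_apply hσ, map_add, map_mul]
    have h2 : (2 : F) = 0 := CharTwo.two_eq_zero
    linear_combination h + (A * a ^ 3 * (y + y ^ 2 + y ^ 3) + B * a * σ a * y * σ y +
      C * a * σ a ^ 2 * (y * σ y + y * σ y ^ 2 + σ y) +
      D * a ^ 2 * σ a * (y * σ y + y + y ^ 2 * σ y) +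
      E * a ^ 2 * σ a ^ 2 * (y * σ y + y * σ y ^ 2 + y + y ^ 2 * σ y + y ^ 2 * σ y ^ 2 + σ y) +
      σ a ^ 3 * (σ y + σ y ^ 2 + σ y ^ 3)) * h2
  rcases hf.eq_zero_or_eq_self h0 ha key with h | h
  · exact .inl ((mul_eq_zero.1 h).resolve_right ha)
  · exact .inr (by simpa [ha] using h)

theorem IsAPN.dillon_ne_zero [Finite F] [CharP F 2] (hf : IsAPN (dillon q A B C D E))
    {σ : F →+* F} (hσ : ∀ x, σ x = x ^ q) {y : F} (hy : σ y = y) (hy0 : y ≠ 0) (hy1 : y ≠ 1)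
    {a : F} (ha : a ≠ 0) :
    A * a ^ 3 + D * a ^ 2 * σ a + C * a * σ a ^ 2 + σ a ^ 3 ≠ 0 := by
  intro h
  refine (hf.dillon_polarisation hσ ha (y := y) ?_).elim hy0 hy1
  rw [hy]
  linear_combination (y ^ 2 + y) * h +
    (B * (a * σ a) * y + 2 * E * (a * σ a) ^ 2 * y ^ 2) * CharTwo.two_eq_zero (R := F)

theorem exists_map_eq_mul [CharP F 2] {σ : F →+* F} (hσ : ∀ x, σ (σ x) = x) {u : F}
    (hu : u * σ u = 1) : ∃ a, a ≠ 0 ∧ σ a = u * a := by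
  by_cases h : u = 1
  · exact ⟨1, one_ne_zero, by simp [h]⟩
  · refine ⟨1 + σ u, fun h0 => h ?_, ?_⟩
    · have := congrArg σ h0
      rw [map_add, hσ, map_one, map_zero] at this
      linear_combination this - CharTwo.two_eq_zero (R := F)
    · rw [map_add, hσ, map_one]
      linear_combination -hu

theorem IsAPN.dillon_cubic_ne_zero [Finite F] [CharP F 2] (hf : IsAPN (dillon q A B C D E))
    {σ : F →+* F} (hσ : ∀ x, σ x = x ^ q) (hσσ : ∀ x, σ (σ x) = x) {y : F} (hy : σ y = y)
    (hy0 : y ≠ 0) (hy1 : y ≠ 1) {u : F} (hu : u * σ u = 1) :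
    A + D * u + C * u ^ 2 + u ^ 3 ≠ 0 := by
  obtain ⟨a, ha, hau⟩ := exists_map_eq_mul hσσ hu
  intro h
  refine hf.dillon_ne_zero hσ hy hy0 hy1 ha ?_
  rw [hau]
  linear_combination a ^ 3 * h

/-- At each direction one of the three binary forms governing the poles of the
parametrisation vanishes. -/
theorem IsAPN.dillon_forms_eq_zero [Finite F] [CharP F 2] (hf : IsAPN (dillon q A B C D E))
    {σ : F →+* F} (hσ : ∀ x, σ x = x ^ q) (hσσ : ∀ x, σ (σ x) = x)
    {ω : F} (hω : ω + σ ω = 1) (hk : 64 ≤ Nat.card (σ.eqLocusField (RingHom.id F)))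
    {a M N : F} (ha : a ≠ 0)
    (hM : M = A * a ^ 3 + D * a ^ 2 * σ a + C * a * σ a ^ 2 + σ a ^ 3) (hM0 : M ≠ 0)
    (hN : N = σ M)
    (hb : B * N + σ B * M ≠ 0) (he : E * N + σ E * M ≠ 0) :
    (A * σ D + C) * a ^ 2 + (A * σ A + D * σ D + C * σ C + 1) * (a * σ a) +
      (σ A * D + σ C) * σ a ^ 2 = 0 := by
  by_contra hQ
  have h2 : (2 : F) = 0 := CharTwo.two_eq_zero
  have hs : σ a ≠ 0 := by simpa using ha
  have hN0 : N ≠ 0 := by rw [hN]; simpa using hM0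
  have hN' : N = σ A * σ a ^ 3 + σ D * σ a ^ 2 * a + σ C * σ a * a ^ 2 + a ^ 3 := by
    rw [hN, hM]; simp [hσσ]
  obtain ⟨l, y, hl0, hl, hy, heq⟩ := exists_sq_add_self_eq hσσ hω hk
    (c₀ := (C * a * σ a ^ 2 + σ a ^ 3) / M) (c₁ := (D * a ^ 2 * σ a + σ a ^ 3) / M)
    (b := B * (a * σ a) / M) (e := E * (a * σ a) ^ 2 / M) (by
      intro h
      simp only [map_add, map_mul, map_pow, map_div₀, hσσ, ← hN] at h
      field_simp at h
      refine hQ ((mul_eq_zero.1 (?_ : (a * σ a) ^ 2 * _ = 0)).resolve_left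
        (pow_ne_zero _ (mul_ne_zero ha hs)))
      rw [hM, hN'] at h
      linear_combination h - (a * σ a ^ 5 * σ D + a * σ a ^ 5 * C * σ A +
        a ^ 2 * σ a ^ 4 * σ D * C + a ^ 2 * σ a ^ 4 * σ C + a ^ 3 * σ a ^ 3 +
        a ^ 3 * σ a ^ 3 * C * σ C + a ^ 4 * σ a ^ 2 * C + a ^ 4 * σ a ^ 2 * D * σ C +
        a ^ 5 * σ a * A * σ C + a ^ 5 * σ a * D + a ^ 6 * A + σ a ^ 6 * σ A) * h2) (by
      intro h
      simp only [map_mul, map_div₀, hσσ, ← hN] at h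
      field_simp at h
      refine hb ((mul_eq_zero.1 (?_ : a * σ a * _ = 0)).resolve_left (mul_ne_zero ha hs))
      linear_combination h) (by
      intro h
      simp only [map_mul, map_pow, map_div₀, hσσ, ← hN] at h
      field_simp at h
      refine he ((mul_eq_zero.1 (?_ : (a * σ a) ^ 2 * _ = 0)).resolve_left
        (pow_ne_zero _ (mul_ne_zero ha hs)))
      linear_combination h)
  have hy01 := hf.dillon_polarisation hσ (a := l * a) (y := y) (mul_ne_zero hl0 ha) (by
    obtain ⟨t, ht⟩ : ∃ t, t = y + σ y := ⟨_, rfl⟩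
    have hσy : σ y = y + t := by linear_combination -ht - y * h2
    rw [← ht] at heq
    simp only [map_mul, hl, hσy]
    have heq' : M * l * (y ^ 2 + y) = l * t ^ 2 * (C * a * σ a ^ 2 + σ a ^ 3 +
        l * (E * (a * σ a) ^ 2)) + t * (l * (D * a ^ 2 * σ a + σ a ^ 3) + B * (a * σ a)) := by
      rw [mul_assoc, heq]; field_simp
    rw [hM] at heq'
    linear_combination l ^ 2 * heq' + (l ^ 2 * a * σ a * B * (y + t) +
      l ^ 3 * a * σ a ^ 2 * C * (y * t + t ^ 2) + l ^ 3 * a ^ 2 * σ a * t * D +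
      l ^ 3 * σ a ^ 3 * (y * t + t + t ^ 2) +
      l ^ 4 * a ^ 2 * σ a ^ 2 * E * (2 * y * t + 2 * y ^ 2 + t ^ 2)) * h2)
  rcases hy01 with rfl | rfl
  · simp at hy
  · simp [h2, one_add_one_eq_two] at hy

open Polynomial in
theorem exists_eval_pow_ne_zero [Fintype F] (hq : 1 < q) (hF : Fintype.card F = q ^ 2) {p : F[X]}
    (hp : p ≠ 0) (hd : p.natDegree ≤ q) : ∃ a, a ≠ 0 ∧ p.eval (a ^ (q - 1)) ≠ 0 := by
  classical
  by_contra! h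
  have hp' : expand F (q - 1) p ≠ 0 := (expand_ne_zero (by omega)).2 hp
  have hsub : (Finset.univ.erase (0 : F)) ⊆ (expand F (q - 1) p).roots.toFinset := by
    intro a ha
    rw [Multiset.mem_toFinset, mem_roots hp', IsRoot.def, expand_eval]
    exact h a (Finset.ne_of_mem_erase ha)
  have h1 := (Finset.card_le_card hsub).trans
    ((Multiset.toFinset_card_le _).trans (card_roots' _))
  rw [Finset.card_erase_of_mem (Finset.mem_univ _), Finset.card_univ, hF, natDegree_expand] at h1
  have h3 := h1.trans (Nat.mul_le_mul_right (q - 1) hd)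
  obtain ⟨r, rfl⟩ := Nat.exists_eq_add_of_lt hq
  have : (1 + r + 1) ^ 2 = (1 + r + 1) * (1 + r + 1 - 1) + (1 + r + 1) := by
    rw [Nat.add_sub_cancel]; ring
  omega

open Polynomial in
theorem Cubic.natDegree_toPoly_le (P : Cubic F) : P.toPoly.natDegree ≤ 3 := by
  rw [Cubic.toPoly]
  compute_degree

theorem Cubic.eval_toPoly (P : Cubic F) (x : F) :
    P.toPoly.eval x = P.a * x ^ 3 + P.b * x ^ 2 + P.c * x + P.d := by
  simp [Cubic.toPoly]

/-- In the unitary case `A A^q = 1`, `D = A C^q` the cubic has `C` as a root of norm one. -/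
theorem IsAPN.dillon_not_unitary [Finite F] [CharP F 2] (hf : IsAPN (dillon q A B C D E))
    {σ : F →+* F} (hσ : ∀ x, σ x = x ^ q) (hσσ : ∀ x, σ (σ x) = x) {y : F} (hy : σ y = y)
    (hy0 : y ≠ 0) (hy1 : y ≠ 1) (h₁ : h1Poly q A B C D = 0) (hB : B * σ C + σ B * D ≠ 0)
    (hA : A * σ A = 1) : D ≠ A * σ C := by
  intro hD
  have h2 : (2 : F) = 0 := CharTwo.two_eq_zero
  have hσD : σ D = σ A * C := by rw [hD, map_mul, hσσ]
  have hA0 : A ≠ 0 := left_ne_zero_of_mul_eq_one hA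
  have hB' : σ B + σ A * B ≠ 0 := by
    intro h
    apply hB
    rw [hD]
    linear_combination A * σ C * h - B * σ C * hA
  have hprod : A * (σ B + σ A * B) ^ 2 * (1 + C * σ C) = 0 := by
    have h : h1Poly q A B C D = A * σ A * (B * σ B) + A * σ B ^ 2 + σ A * B ^ 2 +
        B ^ 2 * σ C * σ D + B * σ B * (C * σ C) + B * σ B * (D * σ D) + B * σ B +
        σ B ^ 2 * C * D := by
      simp only [h1Poly, hσ]
      ring
    rw [h, hσD, hD] at h₁
    linear_combination h₁ + (B ^ 2 * σ A * (1 + C * σ C) - B * σ B * (1 + C * σ C)) * hA +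
      (σ B * B * A * σ A * (1 + C * σ C) - B * σ B * (1 + C * σ C)) * h2
  have hC : C * σ C = 1 := by
    have := (mul_eq_zero.1 hprod).resolve_left (mul_ne_zero hA0 (pow_ne_zero _ hB'))
    linear_combination this - h2
  refine hf.dillon_cubic_ne_zero hσ hσσ hy hy0 hy1 hC ?_
  rw [hD]
  linear_combination A * hC + (A + C ^ 3) * h2

theorem IsAPN.dillon_quadratic_ne_zero [Finite F] [CharP F 2] (hf : IsAPN (dillon q A B C D E))
    {σ : F →+* F} (hσ : ∀ x, σ x = x ^ q) (hσσ : ∀ x, σ (σ x) = x) {y : F} (hy : σ y = y)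
    (hy0 : y ≠ 0) (hy1 : y ≠ 1) (h₁ : h1Poly q A B C D = 0) (hB : B * σ C + σ B * D ≠ 0) :
    (⟨0, σ A * D + σ C, A * σ A + D * σ D + C * σ C + 1, A * σ D + C⟩ : Cubic F).toPoly ≠ 0 := by
  intro h
  have h2 : (2 : F) = 0 := CharTwo.two_eq_zero
  rw [Cubic.toPoly_eq_zero_iff, Cubic.ext_iff] at h
  obtain ⟨-, hb, hc, hd⟩ := h
  change _ = (0 : F) at hb hc hd
  have hprod : (A * σ A + 1) * (D * σ D + 1) = 0 := by
    linear_combination hc - σ C * hd + A * σ D * hb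
  rcases mul_eq_zero.1 hprod with hA | hD
  · refine hf.dillon_not_unitary hσ hσσ hy hy0 hy1 h₁ hB (by linear_combination hA - h2) ?_
    linear_combination D * hA - A * hb
  · obtain ⟨s, hs⟩ := (bijective_frobenius F 2).surjective D
    rw [frobenius_def] at hs
    have hs1 : s * σ s = 1 := by
      have : (s * σ s - 1) ^ 2 = 0 := by
        have hσs : σ s ^ 2 = σ D := by rw [← hs, map_pow]
        linear_combination σ s ^ 2 * hs + D * hσs + hD - s * σ s * h2
      simpa [sub_eq_zero] using this
    refine hf.dillon_cubic_ne_zero hσ hσσ hy hy0 hy1 hs1 ?_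
    linear_combination (C + s) * hs + D * hd - A * hD + (s * D + A) * h2

theorem IsAPN.dillon_eq_zero [Fintype F] [CharP F 2] (hf : IsAPN (dillon q A B C D E))
    {σ : F →+* F} (hσ : ∀ x, σ x = x ^ q) (hq : 64 ≤ q) (hF : Fintype.card F = q ^ 2)
    (h₁ : h1Poly q A B C D = 0) (hB : B * C ^ q + B ^ q * D ≠ 0) : E = 0 := by
  by_contra hE
  rw [← hσ, ← hσ] at hB
  have h2 : (2 : F) = 0 := CharTwo.two_eq_zero
  have hσσ : ∀ x, σ (σ x) = x := fun x => by
    rw [hσ, hσ, ← pow_mul, ← sq, ← hF, FiniteField.pow_card]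
  have hσ' : ∀ x, σ x = x * x ^ (q - 1) := fun x => by
    rw [hσ, ← pow_succ', Nat.sub_add_cancel (by omega)]
  obtain ⟨ω, hω⟩ : ∃ ω, ω + σ ω = 1 := by
    obtain ⟨x, hx0, hx⟩ := exists_eval_pow_ne_zero (by omega) hF
      (Polynomial.X_sub_C_ne_zero (1 : F))
      (by rw [Polynomial.natDegree_X_sub_C]; omega)
    refine exists_add_map_eq_one hσσ (x := x) fun h => ?_
    rw [hσ'] at h
    refine mul_ne_zero hx0 hx ?_
    simp only [Polynomial.eval_sub, Polynomial.eval_X, Polynomial.eval_C]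
    linear_combination h - x * h2
  have hk : 64 ≤ Nat.card (σ.eqLocusField (RingHom.id F)) := by
    have := card_le_card_eqLocusField_sq hσσ hω
    rw [Nat.card_eq_fintype_card, hF] at this
    exact hq.trans ((Nat.pow_le_pow_iff_left two_ne_zero).1 this)
  obtain ⟨y, hy, hy0, hy1⟩ : ∃ y, σ y = y ∧ y ≠ 0 ∧ y ≠ 1 := by
    classical
    obtain ⟨⟨y, hy⟩, hyT⟩ := exists_notMem_of_card_lt
      ({0, 1} : Finset (σ.eqLocusField (RingHom.id F))) (Finset.card_le_two.trans_lt (by omega))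
    simp only [Finset.mem_insert, Finset.mem_singleton, not_or] at hyT
    exact ⟨y, hy, fun h => hyT.1 (Subtype.ext h), fun h => hyT.2 (Subtype.ext h)⟩
  obtain ⟨P, hP⟩ : ∃ P : F → Cubic F, P = fun z =>
    ⟨z * σ A + σ z, z * σ D + σ z * C, z * σ C + σ z * D, z + σ z * A⟩ := ⟨_, rfl⟩
  obtain ⟨Q, hQ⟩ : ∃ Q : Cubic F,
    Q = ⟨0, σ A * D + σ C, A * σ A + D * σ D + C * σ C + 1, A * σ D + C⟩ := ⟨_, rfl⟩
  have hPB : (P B).toPoly ≠ 0 := by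
    rw [Ne, Cubic.toPoly_eq_zero_iff, Cubic.ext_iff]
    rintro ⟨-, -, hc, -⟩
    change _ = (0 : F) at hc
    exact hB (by simpa only [hP] using hc)
  have hPE : (P E).toPoly ≠ 0 := by
    rw [Ne, Cubic.toPoly_eq_zero_iff, Cubic.ext_iff]
    rintro ⟨ha, -, hc, hd⟩
    change _ = (0 : F) at ha hc hd
    simp only [hP] at ha hc hd
    have hσE : σ E ≠ 0 := by simpa using hE
    refine hf.dillon_not_unitary hσ hσσ hy hy0 hy1 h₁ hB (mul_left_cancel₀ hE ?_)
      (mul_left_cancel₀ hσE ?_)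
    · linear_combination A * ha - hd
    · linear_combination hc - σ C * hd
  have hQ0 : Q.toPoly ≠ 0 := hQ ▸ hf.dillon_quadratic_ne_zero hσ hσσ hy hy0 hy1 h₁ hB
  obtain ⟨a, ha, haP⟩ := exists_eval_pow_ne_zero (by omega) hF
    (mul_ne_zero (mul_ne_zero hPB hPE) hQ0)
    (by
      have h1 := Polynomial.natDegree_mul_le (p := (P B).toPoly * (P E).toPoly) (q := Q.toPoly)
      have h2 := Polynomial.natDegree_mul_le (p := (P B).toPoly) (q := (P E).toPoly)
      have h3 := (P B).natDegree_toPoly_le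
      have h4 := (P E).natDegree_toPoly_le
      have h5 := Q.natDegree_toPoly_le
      omega)
  rw [Polynomial.eval_mul, Polynomial.eval_mul] at haP
  obtain ⟨⟨haB, haE⟩, haQ⟩ := (mul_ne_zero_iff.1 haP).imp_left mul_ne_zero_iff.1
  obtain ⟨u, hu⟩ : ∃ u, u = a ^ (q - 1) := ⟨_, rfl⟩
  have hau : σ a = a * u := by rw [hσ', hu]
  rw [← hu, Cubic.eval_toPoly] at haB haE haQ
  have hPz : ∀ z, z * σ (A * a ^ 3 + D * a ^ 2 * σ a + C * a * σ a ^ 2 + σ a ^ 3) +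
      σ z * (A * a ^ 3 + D * a ^ 2 * σ a + C * a * σ a ^ 2 + σ a ^ 3) =
      a ^ 3 * ((P z).a * u ^ 3 + (P z).b * u ^ 2 + (P z).c * u + (P z).d) := by
    intro z
    simp only [map_add, map_mul, map_pow, hσσ, hP]
    rw [hau]
    ring
  have ha3 : a ^ 3 ≠ 0 := pow_ne_zero _ ha
  have := hf.dillon_forms_eq_zero hσ hσσ hω hk ha rfl (hf.dillon_ne_zero hσ hy hy0 hy1 ha) rfl
    (hPz B ▸ mul_ne_zero ha3 haB) (hPz E ▸ mul_ne_zero ha3 haE)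
  refine mul_ne_zero (pow_ne_zero 2 ha) haQ ?_
  rw [← this, hau, hQ]
  ring

end Dillon

theorem statement13 :
    ∃ n₀ : ℕ, 0 < n₀ ∧ ∀ n : ℕ, n₀ ≤ n → ∀ q : ℕ, q = 2 ^ n →
      ∀ (F : Type) [Field F] [Fintype F], Fintype.card F = q ^ 2 →
        ∀ A B C D E : F,
          ¬ CondC1 q A B C D E → ¬ CondC2 q A B C D E →
          h1Poly q A B C D = 0 → B * C ^ q + B ^ q * D ≠ 0 →
          IsAPN (dillon q A B C D E) →
          (C ^ q = A ^ q * B + A ^ q * D + B ^ q ∧ A ^ q * B + B ^ q ≠ 0 ∧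
            B ^ (q + 1) + D ^ (q + 1) + B * D ^ q + B ^ q * D + 1 = 0) ∨
          E = 0 := by
  refine ⟨6, by norm_num, ?_⟩
  rintro n hn q rfl F _ _ hF A B C D E - - h₁ hB hf
  have : Fact (Nat.Prime 2) := ⟨Nat.prime_two⟩
  have : CharP F 2 := charP_of_card_eq_prime_pow (f := n * 2) (by rw [hF, pow_mul])
  exact .inr (hf.dillon_eq_zero (σ := iterateFrobenius F 2 n) (fun x => iterateFrobenius_def 2 n x)
    (Nat.pow_le_pow_right two_pos hn) hF h₁ hB)
end

section
/- Let n be a positive integer, q = 2^n, and A, B, C, D, E ∈ 𝔽_{q²} such that neither condition (C1) nor condition (C2) holds, B ≠ 0, h₁ = 0 (where h₁ := A^{q+1} B^{q+1} + A B^{2q} + A^q B² + B² C^q D^q + B^{q+1} C^{q+1} + B^{q+1} D^{q+1} + B^{q+1} + B^{2q} C D), and B C^q + B^q D = 0. Then B = A B^q and B E^q + B^q E ≠ 0. Moreover, there exists a positive integer n₀ such that for all n ≥ n₀: if the Dillon hexanomial f_{A,B,C,D,E} is APN, then the polynomial B^q T³ + B^q C T² + B C^q T + B has no roots in 𝔽_{q²}.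 -/
/-- A finite field of cardinality `q ^ 2`, with `q` a power of two, has characteristic two. -/
theorem charP_two_of_card {n q : ℕ} (hq : q = 2 ^ n) (F : Type*) [Field F] [Fintype F]
    (hF : Fintype.card F = q ^ 2) : CharP F 2 := by
  have : Fact (Nat.Prime 2) := ⟨Nat.prime_two⟩
  refine charP_of_card_eq_prime_pow (f := n * 2) ?_
  rw [hF, hq, pow_mul]

/-- The `q`-power map on the field with `q ^ 2` elements is an involutive ring homomorphism. -/
theorem exists_conj {n q : ℕ} (hq : q = 2 ^ n) (F : Type*) [Field F] [Fintype F] [CharP F 2]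
    (hF : Fintype.card F = q ^ 2) :
    ∃ σ : F →+* F, (∀ x, x ^ q = σ x) ∧ ∀ x, σ (σ x) = x := by
  have : Fact (Nat.Prime 2) := ⟨Nat.prime_two⟩
  have h : ∀ x, x ^ q = iterateFrobenius F 2 n x := fun x => by rw [iterateFrobenius_def, hq]
  refine ⟨iterateFrobenius F 2 n, h, fun x => ?_⟩
  rw [← h, ← h, ← pow_mul, ← sq, ← hF, FiniteField.pow_card]

/-- The subfield with `q` elements contains an element other than `0` and `1` once `q > 2`. -/
theorem exists_fixed_ne {q : ℕ} (hq : 2 < q) (F : Type*) [Field F] [Fintype F]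
    (hF : Fintype.card F = q ^ 2) : ∃ u : F, u ^ q = u ∧ u ≠ 0 ∧ u ≠ 1 := by
  obtain ⟨z, hz⟩ := IsCyclic.exists_generator (α := Fˣ)
  have hord : orderOf z = q ^ 2 - 1 := by
    rw [orderOf_eq_card_of_forall_mem_zpowers hz, Nat.card_units, Nat.card_eq_fintype_card, hF]
  refine ⟨(z : F) ^ (q + 1), ?_, pow_ne_zero _ z.ne_zero, fun h => ?_⟩
  · have hz' : (z : F) ^ (q ^ 2) = z := by rw [← hF, FiniteField.pow_card]
    calc ((z : F) ^ (q + 1)) ^ q = (z : F) ^ (q ^ 2) * (z : F) ^ q := by ring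
      _ = (z : F) ^ (q + 1) := by rw [hz']; ring
  · have h1 : z ^ (q + 1) = 1 := by ext; simpa using h
    have hle := Nat.le_of_dvd (by lia) (orderOf_dvd_of_pow_eq_one h1)
    rw [hord] at hle
    have : q ^ 2 ≤ q + 2 := by lia
    nlinarith

section Conjugation

variable {F : Type*} [Field F] [CharP F 2] {σ : F →+* F}

theorem eq_mul_conj_of_norm_eq_zero (hσ : ∀ x, σ (σ x) = x) {A B C D : F}
    (hD : B * σ C + σ B * D = 0)
    (h : A * σ A * (B * σ B) + A * σ B ^ 2 + σ A * B ^ 2 + B ^ 2 * σ C * σ D +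
      B * σ B * (C * σ C) + B * σ B * (D * σ D) + B * σ B + σ B ^ 2 * C * D = 0) :
    B = A * σ B := by
  have h2 : (2 : F) = 0 := CharTwo.two_eq_zero
  have hD' : σ B * C + B * σ D = 0 := by
    have := congrArg σ hD
    simpa only [map_add, map_mul, hσ, map_zero] using this
  have hprod : (A * σ B + B) * σ (A * σ B + B) = 0 := by
    simp only [map_add, map_mul, hσ]
    linear_combination h - B * σ C * hD' - σ B * D * hD'
  have hz : A * σ B + B = 0 := by
    rcases mul_eq_zero.mp hprod with h0 | h0
    · exact h0
    · exact (map_eq_zero σ).mp h0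
  linear_combination hz - A * σ B * h2

/-- A cubic over `F` that is self-reciprocal up to conjugation and has a root has a root of
norm one. -/
theorem exists_root_norm_one (hσ : ∀ x, σ (σ x) = x) {B C t : F} (hB : B ≠ 0)
    (ht : σ B * t ^ 3 + σ B * C * t ^ 2 + B * σ C * t + B = 0) :
    ∃ r, r * σ r = 1 ∧ σ B * r ^ 3 + σ B * C * r ^ 2 + B * σ C * r + B = 0 := by
  have h2 : (2 : F) = 0 := CharTwo.two_eq_zero
  by_cases hN : t * σ t = 1
  · exact ⟨t, hN, ht⟩
  have hb : σ B ≠ 0 := (map_ne_zero σ).mpr hB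
  have ht0 : t ≠ 0 := by
    rintro rfl
    apply hB
    simpa using ht
  have hs0 : σ t ≠ 0 := (map_ne_zero σ).mpr ht0
  have htc : B * σ t ^ 3 + B * σ C * σ t ^ 2 + σ B * C * σ t + σ B = 0 := by
    have := congrArg σ ht
    simpa only [map_add, map_mul, map_pow, hσ, map_zero] using this
  obtain ⟨s, hs⟩ : ∃ s, s * σ t = 1 := ⟨(σ t)⁻¹, inv_mul_cancel₀ hs0⟩
  have hsroot : σ B * s ^ 3 + σ B * C * s ^ 2 + B * σ C * s + B = 0 := by
    have : σ t ^ 3 * (σ B * s ^ 3 + σ B * C * s ^ 2 + B * σ C * s + B) = 0 := by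
      linear_combination htc + (σ B * ((s * σ t) ^ 2 + s * σ t + 1)
        + σ B * C * σ t * (s * σ t + 1) + B * σ C * σ t ^ 2) * hs
    exact (mul_eq_zero.mp this).resolve_left (pow_ne_zero 3 hs0)
  have hts : t - s ≠ 0 := fun h => hN (by rw [sub_eq_zero.mp h] at hs ⊢; exact hs)
  have hquad : σ B * (t ^ 2 + t * s + s ^ 2) + σ B * C * (t + s) + B * σ C = 0 := by
    have : (t - s) * (σ B * (t ^ 2 + t * s + s ^ 2) + σ B * C * (t + s) + B * σ C) = 0 := by
      linear_combination ht - hsroot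
    exact (mul_eq_zero.mp this).resolve_left hts
  have hprod : σ B * (t * s * (C + t + s)) = B := by
    linear_combination ht - t * hquad - B * h2 + t * s * σ B * (C + t + s) * h2
  refine ⟨C + t + s, ?_, ?_⟩
  · have hrt : σ B * (t * (C + t + s)) = B * σ t := by
      linear_combination σ t * hprod - σ B * t * (C + t + s) * hs
    have hrt' : B * (σ t * σ (C + t + s)) = σ B * t := by
      have := congrArg σ hrt
      simpa only [map_mul, hσ] using this
    have hne : σ B * B * (t * σ t) ≠ 0 := by simp [hb, hB, ht0, hs0]
    refine mul_left_cancel₀ hne ?_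
    linear_combination (B * (σ t * σ (C + t + s))) * hrt + B * σ t * hrt'
  · linear_combination ht + (C + s) * hquad + σ B * (3 * C * t * s + C * t ^ 2 + C * s ^ 2 +
      2 * C ^ 2 * t + 2 * C ^ 2 * s + C ^ 3 + t * s ^ 2 + t ^ 2 * s) * h2

/-- Hilbert's Theorem 90 for an involution in characteristic two. -/
theorem exists_conj_eq_mul (hσ : ∀ x, σ (σ x) = x) {t : F} (ht : t * σ t = 1) :
    ∃ a ≠ 0, σ a = t * a := by
  by_cases h : t = 1
  · exact ⟨1, one_ne_zero, by simp [h]⟩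
  · refine ⟨1 + σ t, fun h0 => h ?_, ?_⟩
    · have h1 : σ t = 1 := by
        linear_combination h0 - (CharTwo.two_eq_zero : (2 : F) = 0)
      simpa [h1] using ht
    · rw [map_add, map_one, hσ]
      linear_combination -ht

end Conjugation

/-- On a line through `a` where the cubic part vanishes the hexanomial is additive. -/
theorem dillon_add_of_cubic_eq_zero {F : Type*} [Field F] [CharP F 2] {q : ℕ} {A B C D E a u : F}
    (hadd : (u + 1) ^ q = u + 1) (hu : u ^ q = u)
    (ha : A * a ^ 3 + C * (a ^ q) ^ 2 * a + D * a ^ q * a ^ 2 + (a ^ q) ^ 3 = 0) :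
    dillon q A B C D E (a * u + a) + dillon q A B C D E (a * u) = dillon q A B C D E a := by
  have h2 : (2 : F) = 0 := CharTwo.two_eq_zero
  have key : ∀ v : F, v ^ q = v → dillon q A B C D E (a * v) =
      v ^ 2 * (B * a ^ q * a) + v ^ 4 * (E * (a ^ q) ^ 2 * a ^ 2) := by
    intro v hv
    have e : dillon q A B C D E (a * v) = A * (a * v) ^ 3 + B * (a ^ q * v ^ q) * (a * v) +
        C * (a ^ q * v ^ q) ^ 2 * (a * v) + D * (a ^ q * v ^ q) * (a * v) ^ 2 +
        E * (a ^ q * v ^ q) ^ 2 * (a * v) ^ 2 + (a ^ q * v ^ q) ^ 3 := by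
      unfold dillon; ring
    rw [e, hv]
    linear_combination v ^ 3 * ha
  have k1 := key 1 (one_pow q)
  rw [mul_one] at k1
  rw [show a * u + a = a * (u + 1) by ring, key _ hadd, key _ hu, k1]
  linear_combination (B * a ^ q * a * (u ^ 2 + u) +
    E * (a ^ q) ^ 2 * a ^ 2 * (u ^ 4 + 2 * u ^ 3 + 3 * u ^ 2 + 2 * u)) * h2

theorem not_isAPN_of_three {F : Type*} [Field F] [Finite F] {f : F → F} {a b x y z : F}
    (ha : a ≠ 0) (hxy : x ≠ y) (hxz : x ≠ z) (hyz : y ≠ z) (hx : f (x + a) + f x = b)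
    (hy : f (y + a) + f y = b) (hz : f (z + a) + f z = b) : ¬ IsAPN f := by
  intro h
  have hcard : ({x, y, z} : Set F).ncard = 3 := Set.ncard_eq_three.mpr ⟨x, y, z, hxy, hxz, hyz, rfl⟩
  have hsub : ({x, y, z} : Set F) ⊆ {w | f (w + a) + f w = b} := by
    rintro w (rfl | rfl | rfl) <;> assumption
  have := (Set.ncard_le_ncard hsub (Set.toFinite _)).trans (h a b ha)
  lia

theorem eq_mul_pow_of_h1Poly_eq_zero {n q : ℕ} (hq : q = 2 ^ n) {F : Type*} [Field F] [Fintype F]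
    (hF : Fintype.card F = q ^ 2) {A B C D : F} (h1 : h1Poly q A B C D = 0)
    (hD : B * C ^ q + B ^ q * D = 0) : B = A * B ^ q := by
  have := charP_two_of_card hq F hF
  obtain ⟨σ, hpow, hσ⟩ := exists_conj hq F hF
  simp only [h1Poly, pow_succ, pow_mul', hpow, pow_zero, one_mul] at h1 hD ⊢
  refine eq_mul_conj_of_norm_eq_zero hσ hD ?_
  linear_combination h1

theorem mul_pow_add_ne_zero {n q : ℕ} (hq : q = 2 ^ n) {F : Type*} [Field F]
    [Fintype F] (hF : Fintype.card F = q ^ 2) {A B C D E : F} (hC1 : ¬ CondC1 q A B C D E)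
    (hC2 : ¬ CondC2 q A B C D E) (hB : B ≠ 0) (hD : B * C ^ q + B ^ q * D = 0)
    (hA : B = A * B ^ q) : B * E ^ q + B ^ q * E ≠ 0 := by
  have := charP_two_of_card hq F hF
  have h2 : (2 : F) = 0 := CharTwo.two_eq_zero
  obtain ⟨σ, hpow, hσ⟩ := exists_conj hq F hF
  intro hE
  simp only [CondC1, CondC2, pow_succ, hpow] at hC1 hC2 hD hA hE
  have hb : σ B ≠ 0 := (map_ne_zero σ).mpr hB
  have hA0 : A ≠ 0 := by
    rintro rfl
    exact hB (by simpa using hA)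
  have hA' : σ B = σ A * B := by
    have := congrArg σ hA
    simpa only [map_mul, hσ] using this
  have hAE : σ E = σ A * E := by
    refine mul_left_cancel₀ hB ?_
    linear_combination hE - E * hA' - B * σ A * E * h2
  have hDC : D = A * σ C := by
    refine mul_left_cancel₀ hb ?_
    linear_combination hD - σ C * hA - σ B * A * σ C * h2
  by_cases hC : C = 0
  · exact hC1 ⟨hA0, hC, by simp [hDC, hC], hA'.symm, hAE.symm⟩
  · have hN : σ A * A = 1 := by
      refine mul_left_cancel₀ hB ?_
      linear_combination -A * hA' - hA
    exact hC2 ⟨hA0, hC, by simp [hDC, hA0, hC], hN, hDC, hA', hAE⟩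

theorem not_isAPN_of_root {n q : ℕ} (hn : 2 ≤ n) (hq : q = 2 ^ n) {F : Type*} [Field F] [Fintype F]
    (hF : Fintype.card F = q ^ 2) {A B C D E t : F} (hB : B ≠ 0)
    (hD : B * C ^ q + B ^ q * D = 0) (hA : B = A * B ^ q)
    (ht : B ^ q * t ^ 3 + B ^ q * C * t ^ 2 + B * C ^ q * t + B = 0) :
    ¬ IsAPN (dillon q A B C D E) := by
  have := charP_two_of_card hq F hF
  have h2 : (2 : F) = 0 := CharTwo.two_eq_zero
  have hq2 : 2 < q := by
    have := Nat.pow_le_pow_right (n := 2) (by lia) hn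
    lia
  obtain ⟨u, hu, hu0, hu1⟩ := exists_fixed_ne hq2 F hF
  obtain ⟨σ, hpow, hσ⟩ := exists_conj hq F hF
  simp only [hpow] at hD hA ht
  have hb : σ B ≠ 0 := (map_ne_zero σ).mpr hB
  obtain ⟨r, hr, hroot⟩ := exists_root_norm_one hσ hB ht
  obtain ⟨a, ha0, ha⟩ := exists_conj_eq_mul hσ hr
  have hadd : (u + 1) ^ q = u + 1 := by rw [hpow, map_add, ← hpow, hu, map_one]
  have hcubic : A * a ^ 3 + C * (a ^ q) ^ 2 * a + D * a ^ q * a ^ 2 + (a ^ q) ^ 3 = 0 := by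
    rw [hpow, ha]
    refine (mul_eq_zero.mp (?_ : σ B * _ = 0)).resolve_left hb
    linear_combination a ^ 3 * (hroot + r * hD - hA) - a ^ 3 * r * B * σ C * h2
  have hq0 : q ≠ 0 := by lia
  have h0 : dillon q A B C D E 0 = 0 := by simp [dillon, hq0]
  refine not_isAPN_of_three (x := 0) (y := a) (z := a * u) (b := dillon q A B C D E a)
    ha0 ha0.symm (mul_ne_zero ha0 hu0).symm ?_ ?_ ?_ (dillon_add_of_cubic_eq_zero hadd hu hcubic)
  · intro h
    exact hu1 (mul_left_cancel₀ ha0 (by rw [mul_one, ← h]))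
  · rw [zero_add, h0, add_zero]
  · rw [CharTwo.add_self_eq_zero, h0, zero_add]

theorem statement14 :
    (∀ n q : ℕ, 0 < n → q = 2 ^ n →
      ∀ (F : Type) [Field F] [Fintype F], Fintype.card F = q ^ 2 →
        ∀ A B C D E : F,
          ¬ CondC1 q A B C D E → ¬ CondC2 q A B C D E → B ≠ 0 →
          h1Poly q A B C D = 0 → B * C ^ q + B ^ q * D = 0 →
          B = A * B ^ q ∧ B * E ^ q + B ^ q * E ≠ 0) ∧
    (∃ n₀ : ℕ, 0 < n₀ ∧ ∀ n q : ℕ, n₀ ≤ n → q = 2 ^ n →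
      ∀ (F : Type) [Field F] [Fintype F], Fintype.card F = q ^ 2 →
        ∀ A B C D E : F,
          ¬ CondC1 q A B C D E → ¬ CondC2 q A B C D E → B ≠ 0 →
          h1Poly q A B C D = 0 → B * C ^ q + B ^ q * D = 0 →
          IsAPN (dillon q A B C D E) →
          ∀ t : F, B ^ q * t ^ 3 + B ^ q * C * t ^ 2 + B * C ^ q * t + B ≠ 0) := by
  refine ⟨?_, 2, two_pos, ?_⟩
  · intro n q _ hq F _ _ hF A B C D E hC1 hC2 hB h1 hD
    have hA := eq_mul_pow_of_h1Poly_eq_zero hq hF h1 hD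
    exact ⟨hA, mul_pow_add_ne_zero hq hF hC1 hC2 hB hD hA⟩
  · intro n q hn hq F _ _ hF A B C D E _ _ hB h1 hD hAPN t ht
    exact not_isAPN_of_root hn hq hF hB hD
      (eq_mul_pow_of_h1Poly_eq_zero hq hF h1 hD) ht hAPN
end

section
/- There exists a positive integer n₀ such that for every integer n ≥ n₀, setting q = 2^n, and for all A, B, C, D, E ∈ 𝔽_{q²} such that A^{q+1} = 1, C = A D^q, B ≠ 0, A E^q + E ≠ 0, and A B^q + B = 0: if the Dillon hexanomial f_{A,B,C,D,E} is APN, then the polynomial T³ + A D^q T² + D T + A has no roots in 𝔽_{q²}. -/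
/-- A monic cubic in characteristic two with two distinct roots `t`, `v` has the third root
`t + v + c`, and the product of the three roots is the constant term. -/
theorem cubic_third_root {F : Type*} [Field F] (h2 : (2 : F) = 0) {c d a t v : F}
    (ht : t ^ 3 + c * t ^ 2 + d * t + a = 0) (hv : v ^ 3 + c * v ^ 2 + d * v + a = 0)
    (htv : t ≠ v) :
    (t + v + c) ^ 3 + c * (t + v + c) ^ 2 + d * (t + v + c) + a = 0 ∧
      t * v * (t + v + c) = a := by
  have hd : t ^ 2 + t * v + v ^ 2 + c * (t + v) + d = 0 := by
    apply mul_left_cancel₀ (sub_ne_zero.mpr htv)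
    linear_combination ht - hv
  have hp : t * v * (t + v + c) = a := by
    linear_combination t * hd - ht
  refine ⟨?_, hp⟩
  obtain rfl : d = -(t ^ 2 + t * v + v ^ 2 + c * (t + v)) := by linear_combination hd
  subst hp
  linear_combination h2 * (c ^ 3 + 2 * c ^ 2 * (t + v) + c * (t ^ 2 + 3 * t * v + v ^ 2) +
    t * v * (t + v))

/-- A root of the self-reciprocal cubic can be replaced by one of norm one. -/
theorem exists_norm_one_root {F : Type*} [Field F] (h2 : (2 : F) = 0) (q : ℕ)
    (hadd : ∀ x y : F, (x + y) ^ q = x ^ q + y ^ q) (hinv : ∀ x : F, (x ^ q) ^ q = x)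
    {A D t : F} (hA : A ^ (q + 1) = 1)
    (ht : t ^ 3 + A * D ^ q * t ^ 2 + D * t + A = 0) :
    ∃ r : F, r ^ q * r = 1 ∧ r ^ 3 + A * D ^ q * r ^ 2 + D * r + A = 0 := by
  have hA' : A ^ q * A = 1 := by rw [← pow_succ, hA]
  have hA0 : A ≠ 0 := right_ne_zero_of_mul_eq_one hA'
  have hq0 : q ≠ 0 := by
    rintro rfl
    simpa using hadd 0 0
  have ht0 : t ≠ 0 := by
    rintro rfl
    exact hA0 (by simpa using ht)
  have hu0 : t ^ q ≠ 0 := pow_ne_zero q ht0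
  have hv : (t ^ q)⁻¹ ^ 3 + A * D ^ q * (t ^ q)⁻¹ ^ 2 + D * (t ^ q)⁻¹ + A = 0 := by
    have h : (t ^ q) ^ 3 + A ^ q * D * (t ^ q) ^ 2 + D ^ q * t ^ q + A ^ q = 0 := by
      have h := congrArg (· ^ q) ht
      simp only [hadd, mul_pow, hinv, zero_pow hq0] at h
      rw [← h]
      ring
    field_simp
    linear_combination A * h - (D * (t ^ q) ^ 2 + 1) * hA'
  by_cases h : t = (t ^ q)⁻¹
  · refine ⟨t, ?_, ht⟩
    nth_rw 2 [h]
    exact mul_inv_cancel₀ hu0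
  obtain ⟨hr, hp⟩ := cubic_third_root h2 ht hv h
  refine ⟨_, ?_, hr⟩
  set r := t + (t ^ q)⁻¹ + A * D ^ q
  have hr1 : t * r = A * t ^ q := by
    rw [← hp]
    field_simp
  have hr2 : t ^ q * r ^ q = A ^ q * t := by
    simpa only [mul_pow, hinv] using congrArg (· ^ q) hr1
  apply mul_left_cancel₀ (mul_ne_zero hu0 ht0)
  linear_combination (t * r) * hr2 + A ^ q * t * hr1 + t ^ q * t * hA'

/-- Hilbert 90 for an additive involution `x ↦ x ^ q`. -/
theorem exists_pow_eq_mul {F : Type*} [Field F] (h2 : (2 : F) = 0) (q : ℕ)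
    (hadd : ∀ x y : F, (x + y) ^ q = x ^ q + y ^ q) (hinv : ∀ x : F, (x ^ q) ^ q = x)
    {r : F} (hr : r ^ q * r = 1) : ∃ a : F, a ≠ 0 ∧ a ^ q = r * a := by
  by_cases h : r = 1
  · exact ⟨1, one_ne_zero, by simp [h]⟩
  refine ⟨1 + r ^ q, fun h0 => h ?_, ?_⟩
  · linear_combination r * h0 - hr - h2
  · rw [hadd, one_pow, hinv]
    linear_combination -hr

/-- For `q > 2`, the field with `q ^ 2` elements has an element other than `0`, `1` that is
fixed by `x ↦ x ^ q`. -/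
theorem exists_fixed_ne_zero_ne_one {F : Type*} [Field F] [Fintype F] {q : ℕ} (hq : 2 < q)
    (hcard : Fintype.card F = q ^ 2) : ∃ s : F, s ≠ 0 ∧ s ≠ 1 ∧ s ^ q = s := by
  classical
  obtain ⟨y, hy⟩ := IsCyclic.exists_generator (α := Fˣ)
  have ho : orderOf y = q ^ 2 - 1 := by
    rw [orderOf_eq_card_of_forall_mem_zpowers hy, Nat.card_eq_fintype_card, Fintype.card_units,
      hcard]
  refine ⟨((y ^ (q + 1) : Fˣ) : F), Units.ne_zero _, fun h => ?_, ?_⟩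
  · have hd := orderOf_dvd_of_pow_eq_one (Units.ext h : y ^ (q + 1) = 1)
    have hle := Nat.le_of_dvd (Nat.succ_pos q) hd
    rw [ho] at hle
    have : 3 * q ≤ q ^ 2 := by nlinarith
    omega
  · have h : (y : F) ^ q ^ 2 = y := by rw [← hcard, FiniteField.pow_card]
    calc ((y ^ (q + 1) : Fˣ) : F) ^ q = (y : F) ^ q ^ 2 * (y : F) ^ q := by push_cast; ring
      _ = ((y ^ (q + 1) : Fˣ) : F) := by rw [h]; push_cast; ring

/-- On the fixed line through `a`, the Dillon hexanomial only involves the norm of `a` when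
`a ^ q / a` is a root of the associated cubic. -/
theorem dillon_mul_eq {F : Type*} [Field F] (q : ℕ) {A B C D E a r s : F}
    (ha : a ^ q = r * a) (hs : s ^ q = s)
    (hr : r ^ 3 + C * r ^ 2 + D * r + A = 0) :
    dillon q A B C D E (s * a) = B * (r * a ^ 2) * s ^ 2 + E * (r * a ^ 2) ^ 2 * s ^ 4 := by
  have h : (s * a) ^ q = s * (r * a) := by rw [mul_pow, hs, ha]
  simp only [dillon, pow_add, pow_mul', h, pow_one]
  linear_combination s ^ 3 * a ^ 3 * hr

theorem statement17 :
    ∃ n₀ : ℕ, 0 < n₀ ∧ ∀ n : ℕ, n₀ ≤ n → ∀ q : ℕ, q = 2 ^ n →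
      ∀ (F : Type) [Field F] [Fintype F], Fintype.card F = q ^ 2 →
        ∀ A B C D E : F,
          A ^ (q + 1) = 1 → C = A * D ^ q → B ≠ 0 →
          A * E ^ q + E ≠ 0 → A * B ^ q + B = 0 →
          IsAPN (dillon q A B C D E) →
          ∀ t : F, t ^ 3 + A * D ^ q * t ^ 2 + D * t + A ≠ 0 := by
  refine ⟨2, by norm_num, ?_⟩
  rintro n hn q rfl F _ _ hcard A B C D E hA rfl - - - hAPN t ht
  have hchar : CharP F 2 := by
    refine charP_of_card_eq_prime_pow (f := n * 2) ?_
    rw [hcard, pow_mul]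
  have h2 : (2 : F) = 0 := CharTwo.two_eq_zero
  have hadd : ∀ x y : F, (x + y) ^ 2 ^ n = x ^ 2 ^ n + y ^ 2 ^ n :=
    fun x y => add_pow_char_pow x y 2 n
  have hinv : ∀ x : F, (x ^ 2 ^ n) ^ 2 ^ n = x := fun x => by
    rw [← pow_mul, ← pow_two, ← hcard, FiniteField.pow_card]
  have hq : 2 < 2 ^ n := lt_of_lt_of_le (by norm_num) (Nat.pow_le_pow_right two_pos hn)
  obtain ⟨r, hr1, hr⟩ := exists_norm_one_root h2 _ hadd hinv hA ht
  obtain ⟨a, ha0, ha⟩ := exists_pow_eq_mul h2 _ hadd hinv hr1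
  obtain ⟨s, hs0, hs1, hs⟩ := exists_fixed_ne_zero_ne_one hq hcard
  have hsol : ∀ x : F, x ^ 2 ^ n = x →
      dillon (2 ^ n) A B (A * D ^ 2 ^ n) D E (x * a + a) +
        dillon (2 ^ n) A B (A * D ^ 2 ^ n) D E (x * a) =
          B * (r * a ^ 2) + E * (r * a ^ 2) ^ 2 := fun x hx => by
    have hx1 : (x + 1) ^ 2 ^ n = x + 1 := by rw [hadd, hx, one_pow]
    rw [← add_one_mul, dillon_mul_eq _ ha hx hr, dillon_mul_eq _ ha hx1 hr]
    linear_combination h2 * (B * (r * a ^ 2) * (x ^ 2 + x) +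
      E * (r * a ^ 2) ^ 2 * (x ^ 4 + 2 * x ^ 3 + 3 * x ^ 2 + 2 * x))
  have hsub : ({0 * a, 1 * a, s * a} : Set F) ⊆
      {x | dillon (2 ^ n) A B (A * D ^ 2 ^ n) D E (x + a) +
        dillon (2 ^ n) A B (A * D ^ 2 ^ n) D E x = B * (r * a ^ 2) + E * (r * a ^ 2) ^ 2} := by
    rintro x (rfl | rfl | rfl)
    · exact hsol 0 (zero_pow (by positivity))
    · exact hsol 1 (one_pow _)
    · exact hsol s hs
  have hthree : ({0 * a, 1 * a, s * a} : Set F).ncard = 3 :=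
    Set.ncard_eq_three.mpr ⟨_, _, _, by simpa using ha0.symm, by simp [ha0, hs0],
      fun h => hs1 (mul_right_cancel₀ ha0 h).symm, rfl⟩
  have hle := (Set.ncard_le_ncard hsub (Set.toFinite _)).trans (hAPN a _ ha0)
  omega
end

section
/- Let K be an algebraically closed field of characteristic 2 and let A ∈ K with A ≠ 0. Then the polynomial H = A·Z₀·X₀² + A·Z₀²·X₀ + X₁²·Z₁ + X₁·Z₁² is irreducible in the polynomial ring K[X₀, X₁, Z₀, Z₁]. -/
/-- A quadratic polynomial whose leading coefficient is a prime dividing the linear coefficient but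
not the constant one is irreducible (a reversed form of Eisenstein's criterion). -/
theorem Polynomial.irreducible_quadratic_of_prime_leadingCoeff {R : Type*} [CommRing R] [IsDomain R]
    {p c : R} (hp : Prime p) (b : R) (hc : ¬ p ∣ c) :
    Irreducible (C p * X ^ 2 + C (p * b) * X + C c : Polynomial R) := by
  have hdeg := natDegree_quadratic (b := p * b) (c := c) hp.ne_zero
  have isUnit_of_natDegree : ∀ g h : Polynomial R,
      C p * X ^ 2 + C (p * b) * X + C c = g * h → g.natDegree = 0 → IsUnit g := by
    intro g h hgh hg
    obtain ⟨r, rfl⟩ := natDegree_eq_zero.mp hg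
    have h2 := congrArg (coeff · 2) hgh
    have h0 := congrArg (coeff · 0) hgh
    simp [coeff_X, coeff_C] at h2 h0
    exact isUnit_C.mpr ((hp.irreducible.isRelPrime_iff_not_dvd.mpr hc) ⟨_, h2⟩ ⟨_, h0⟩)
  refine ⟨fun hu ↦ ?_, fun g h hgh ↦ ?_⟩
  · rw [natDegree_eq_zero_of_isUnit hu] at hdeg
    omega
  have hne : g * h ≠ 0 := fun h0 ↦ by
    rw [hgh, h0, natDegree_zero] at hdeg
    omega
  have hsum : g.natDegree + h.natDegree = 2 := by
    rw [← natDegree_mul (left_ne_zero_of_mul hne) (right_ne_zero_of_mul hne), ← hgh, hdeg]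
  obtain hg | hh | ⟨hg, hh⟩ : g.natDegree = 0 ∨ h.natDegree = 0 ∨
      g.natDegree = 1 ∧ h.natDegree = 1 := by omega
  · exact .inl (isUnit_of_natDegree g h hgh hg)
  · exact .inr (isUnit_of_natDegree h g (hgh.trans (mul_comm g h)) hh)
  exfalso
  obtain ⟨s, -, t, rfl⟩ := natDegree_eq_one.mp hg
  obtain ⟨u, -, v, rfl⟩ := natDegree_eq_one.mp hh
  have hexp : (C s * X + C t) * (C u * X + C v) =
      C (s * u) * X ^ 2 + C (s * v + t * u) * X + C (t * v) := by
    simp only [map_add, map_mul]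
    ring
  rw [hexp] at hgh
  have h2 := congrArg (coeff · 2) hgh
  have h1 := congrArg (coeff · 1) hgh
  have h0 := congrArg (coeff · 0) hgh
  simp [coeff_X, coeff_C, -map_add, -map_mul] at h2 h1 h0
  have hs : ¬ (p ∣ s ∧ p ∣ t) := fun h ↦ hc (h0 ▸ h.2.mul_right v)
  have hu : ¬ (p ∣ u ∧ p ∣ v) := fun h ↦ hc (h0 ▸ h.2.mul_left t)
  have hsu : ¬ (p ∣ s ∧ p ∣ u) := by
    rintro ⟨⟨x, rfl⟩, ⟨y, rfl⟩⟩
    refine hp.not_isUnit (IsUnit.of_mul_eq_one (x * y) (mul_left_cancel₀ hp.ne_zero ?_))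
    linear_combination -h2
  have hst : p ∣ s * v + t * u := ⟨b, h1.symm⟩
  obtain h | h := hp.dvd_or_dvd (show p ∣ s * u from h2 ▸ dvd_rfl)
  · obtain h' | h' := hp.dvd_or_dvd ((dvd_add_right (h.mul_right v)).mp hst)
    · exact hs ⟨h, h'⟩
    · exact hsu ⟨h, h'⟩
  · obtain h' | h' := hp.dvd_or_dvd ((dvd_add_left (h.mul_left t)).mp hst)
    · exact hsu ⟨h', h⟩
    · exact hu ⟨h, h'⟩

open MvPolynomial in
theorem statement18 (K : Type) [Field K] [IsAlgClosed K] [CharP K 2]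
    (A : K) (hA : A ≠ 0) :
    Irreducible
      (MvPolynomial.C A * X 2 * X 0 ^ 2 + MvPolynomial.C A * X 2 ^ 2 * X 0 +
        X 1 ^ 2 * X 3 + X 1 * X 3 ^ 2 : MvPolynomial (Fin 4) K) := by
  have hunit : IsUnit (C A : MvPolynomial (Fin 3) K) := (isUnit_iff_ne_zero.mpr hA).map C
  have hX : Prime (X 1 : MvPolynomial (Fin 3) K) := X_prime
  have hassoc : Associated (X 1 : MvPolynomial (Fin 3) K) (C A * X 1) :=
    associated_unit_mul_right _ _ hunit
  have hc : ¬ (C A * X 1 : MvPolynomial (Fin 3) K) ∣ X 0 * X 2 * (X 0 + X 2) := by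
    rw [← hassoc.dvd_iff_dvd_left, hX.dvd_mul, hX.dvd_mul, X_dvd_X, X_dvd_X]
    rintro ((h | h) | ⟨q, hq⟩)
    · exact absurd h (by decide)
    · exact absurd h (by decide)
    · simpa using congrArg (eval ![1, 0, 0]) hq
  rw [← MulEquiv.irreducible_iff (finSuccEquiv K 3)]
  convert Polynomial.irreducible_quadratic_of_prime_leadingCoeff (hassoc.prime hX) (X 1) hc using 1
  have h1 : finSuccEquiv K 3 (X 1) = Polynomial.C (X 0) := finSuccEquiv_X_succ (j := 0)
  have h2 : finSuccEquiv K 3 (X 2) = Polynomial.C (X 1) := finSuccEquiv_X_succ (j := 1)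
  have h3 : finSuccEquiv K 3 (X 3) = Polynomial.C (X 2) := finSuccEquiv_X_succ (j := 2)
  have hCA : finSuccEquiv K 3 (C A) = Polynomial.C (C A) := by simp [finSuccEquiv_apply]
  simp only [map_add, map_mul, map_pow, h1, h2, h3, hCA, finSuccEquiv_X_zero]
  ring
end

section
/- Let K be an algebraically closed field of characteristic 2 and let A, B, E ∈ K with A ≠ 0 and (B, E) ≠ (0, 0). Then the polynomial H = (A·Z₀ + E·Z₁²)·X₀² + (A·Z₀² + B·Z₁)·X₀ + X₁·(B·Z₀ + E·X₁·Z₀² + X₁·Z₁ + Z₁²) is irreducible in the polynomial ring K[X₀, X₁, Z₀, Z₁]. -/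
open Polynomial in
theorem Polynomial.coeff_two_quadratic {R : Type*} [Semiring R] (a b c : R) :
    (C a * X ^ 2 + C b * X + C c).coeff 2 = a := by
  simp

open Polynomial in
/-- A quadratic polynomial over a domain whose leading coefficient is irreducible and does not
divide the constant coefficient is irreducible as soon as it has no root. -/
theorem Polynomial.irreducible_quadratic_of_irreducible_leadingCoeff {R : Type*} [CommRing R]
    [IsDomain R] {a b c : R} (ha : Irreducible a) (hac : ¬ a ∣ c)
    (hroot : ∀ x, a * x ^ 2 + b * x + c ≠ 0) :
    Irreducible (C a * X ^ 2 + C b * X + C c) := by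
  set P : R[X] := C a * X ^ 2 + C b * X + C c with hP
  have hdeg : P.natDegree = 2 := natDegree_quadratic ha.ne_zero
  have hc2 : P.coeff 2 = a := coeff_two_quadratic a b c
  have hc0 : P.coeff 0 = c := by simp [hP]
  have hconst : ∀ r : R, ∀ g, P = C r * g → IsUnit r := by
    intro r g h
    have h2 : a = r * g.coeff 2 := by rw [← hc2, h, coeff_C_mul]
    have h0 : c = r * g.coeff 0 := by rw [← hc0, h, coeff_C_mul]
    refine (ha.isUnit_or_isUnit h2).resolve_right fun hu => hac ?_
    rw [h2, h0]
    exact mul_dvd_mul_left r hu.dvd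
  have hlin : ∀ f g, P = f * g → f.natDegree = 1 → ¬ IsUnit (f.coeff 1) := by
    rintro f g h hf ⟨u, hu⟩
    apply hroot (-(↑u⁻¹ * f.coeff 0))
    have h1 : P.eval (-(↑u⁻¹ * f.coeff 0)) = 0 := by
      rw [h, eval_mul, eq_X_add_C_of_natDegree_le_one hf.le, ← hu]
      simp
    simpa [hP] using h1
  refine ⟨fun h => ?_, fun f g h => ?_⟩
  · rw [natDegree_eq_zero_of_isUnit h] at hdeg
    omega
  · have h0 : f * g ≠ 0 := by
      rw [← h]
      rintro h0
      simp [h0] at hdeg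
    obtain ⟨hf0, hg0⟩ := mul_ne_zero_iff.mp h0
    have hsum : f.natDegree + g.natDegree = 2 := by
      rw [← natDegree_mul hf0 hg0, ← h, hdeg]
    obtain hf | hf | hf : f.natDegree = 0 ∨ f.natDegree = 1 ∨ g.natDegree = 0 := by omega
    · rw [eq_C_of_natDegree_eq_zero hf] at h ⊢
      exact Or.inl ((hconst _ _ h).map C)
    · have hg : g.natDegree = 1 := by omega
      have hl : a = f.coeff 1 * g.coeff 1 := by
        rw [← hc2, h, ← coeff_mul_add_eq_of_natDegree_le hf.le hg.le]
      rcases ha.isUnit_or_isUnit hl with hu | hu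
      · exact absurd hu (hlin f g h hf)
      · exact absurd hu (hlin g f (h.trans (mul_comm f g)) hg)
    · rw [eq_C_of_natDegree_eq_zero hf, mul_comm] at h
      rw [eq_C_of_natDegree_eq_zero hf]
      exact Or.inr ((hconst _ _ h).map C)

open Polynomial in
/-- If `q` is a polynomial root of a quadratic equation `a * q ^ 2 + b * q + c = 0`
with constant `a`, `b` and `c` of degree at most two, then minus the quadratic coefficient of `c` is
`a` times a square. -/
theorem Polynomial.exists_mul_sq_add_coeff_two_eq_zero {R : Type*} [CommRing R] [IsDomain R]
    {a b : R} {c q : R[X]} (ha : a ≠ 0) (hc : c.natDegree ≤ 2)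
    (h : C a * q ^ 2 + C b * q + c = 0) : ∃ r, a * r ^ 2 + c.coeff 2 = 0 := by
  have hq : q.natDegree ≤ 1 := by
    by_contra! hd
    have hlead := congr_arg (coeff · (2 * q.natDegree)) h
    simp only [coeff_add, coeff_C_mul, coeff_zero] at hlead
    rw [coeff_eq_zero_of_natDegree_lt (p := q) (by omega),
      coeff_eq_zero_of_natDegree_lt (p := c) (by omega), coeff_pow_mul_natDegree] at hlead
    have hq0 : q ≠ 0 := by
      rintro rfl
      simp at hd
    simp [ha, hq0] at hlead
  refine ⟨q.coeff 1, ?_⟩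
  have h2 := congr_arg (coeff · 2) h
  have hsq := coeff_pow_of_natDegree_le (m := 2) hq
  simp only [coeff_add, coeff_C_mul, coeff_zero] at h2
  rw [coeff_eq_zero_of_natDegree_lt (p := q) (n := 2) (by omega)] at h2
  rw [mul_one] at hsq
  rw [hsq] at h2
  simpa using h2

theorem exists_mul_add_mul_sq_eq_zero_and_ne_zero {K : Type*} [Field K] [Infinite K] {A : K}
    (hA : A ≠ 0) (E : K) : ∃ z w : K, A * z + E * w ^ 2 = 0 ∧ E * z ^ 2 + w ≠ 0 := by
  by_contra! h
  have hp : (Polynomial.C (E * (E / A) ^ 2) * Polynomial.X ^ 4 + Polynomial.X :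
      Polynomial K) = 0 := by
    refine Polynomial.funext fun w => ?_
    have hw := h (-(E / A) * w ^ 2) w (by field_simp; ring)
    simp only [Polynomial.eval_add, Polynomial.eval_mul, Polynomial.eval_C, Polynomial.eval_pow,
      Polynomial.eval_X, Polynomial.eval_zero]
    linear_combination hw
  have h1 := congr_arg (Polynomial.coeff · 1) hp
  rw [Polynomial.coeff_add, Polynomial.coeff_C_mul] at h1
  simp [Polynomial.coeff_X_pow] at h1

namespace MvPolynomial

theorem irreducible_C_mul_X_add_C_mul_X_sq {K σ : Type*} [Field K] {A : K} (hA : A ≠ 0) (E : K)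
    {i j : σ} (hij : i ≠ j) : Irreducible (C A * X i + C E * X j ^ 2) := by
  refine irreducible_mul_X_add _ _ i (by simpa using hA) (by simp) (fun hi => ?_)
    (((isUnit_iff_ne_zero.mpr hA).map C).isRelPrime_left)
  have := vars_pow (X j : MvPolynomial σ K) 2
  classical
  have hi' := vars_mul _ _ hi
  simp only [vars_C, Finset.empty_union] at hi'
  simpa [hij] using this hi'

end MvPolynomial

open MvPolynomial in
theorem statement19 (K : Type) [Field K] [IsAlgClosed K] [CharP K 2]
    (A B E : K) (hA : A ≠ 0) (hBE : (B, E) ≠ (0, 0)) :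
    Irreducible
      ((MvPolynomial.C A * X 2 + MvPolynomial.C E * X 3 ^ 2) * X 0 ^ 2 +
        (MvPolynomial.C A * X 2 ^ 2 + MvPolynomial.C B * X 3) * X 0 +
        X 1 * (MvPolynomial.C B * X 2 + MvPolynomial.C E * X 1 * X 2 ^ 2 +
          X 1 * X 3 + X 3 ^ 2) : MvPolynomial (Fin 4) K) := by
  obtain ⟨z, w, hzw, hzw'⟩ := exists_mul_add_mul_sq_eq_zero_and_ne_zero hA E
  refine .of_map (f := finSuccEquiv K 3) ?_
  have h1 : (1 : Fin 4) = Fin.succ 0 := rfl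
  have h2 : (2 : Fin 4) = Fin.succ 1 := rfl
  have h3 : (3 : Fin 4) = Fin.succ 2 := rfl
  have hC (r : K) (n : ℕ) : finSuccEquiv K n (C r) = Polynomial.C (C r) :=
    (finSuccEquiv K n).commutes r
  have key := Polynomial.irreducible_quadratic_of_irreducible_leadingCoeff
    (a := (C A * X 1 + C E * X 2 ^ 2 : MvPolynomial (Fin 3) K))
    (b := C A * X 1 ^ 2 + C B * X 2)
    (c := X 0 * (C B * X 1 + C E * X 0 * X 1 ^ 2 + X 0 * X 2 + X 2 ^ 2))
    (irreducible_C_mul_X_add_C_mul_X_sq hA E (by decide)) ?_ ?_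
  · convert key using 1
    simp only [map_add, map_mul, map_pow, h1, h2, h3, finSuccEquiv_X_zero, finSuccEquiv_X_succ, hC]
  · rintro ⟨d, hd⟩
    have h := congr_arg (aeval ![Polynomial.X, Polynomial.C z, Polynomial.C w]) hd
    have ha : (Polynomial.C A * Polynomial.C z + Polynomial.C E * Polynomial.C w ^ 2 :
        Polynomial K) = 0 := by
      rw [← Polynomial.C_pow, ← Polynomial.C_mul, ← Polynomial.C_mul, ← Polynomial.C_add, hzw,
        Polynomial.C_0]
    simp only [map_mul, map_add, map_pow, aeval_X, algHom_C, Polynomial.algebraMap_eq,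
      Matrix.cons_val] at h
    rw [ha, zero_mul] at h
    have hquad : (Polynomial.C (E * z ^ 2 + w) * Polynomial.X ^ 2 +
        Polynomial.C (B * z + w ^ 2) * Polynomial.X + Polynomial.C 0 : Polynomial K) = 0 := by
      rw [← h]
      simp only [Polynomial.C_add, Polynomial.C_mul, Polynomial.C_pow, Polynomial.C_0]
      ring
    exact hzw' ((Polynomial.coeff_two_quadratic _ _ _).symm.trans
      (congr_arg (Polynomial.coeff · 2) hquad))
  · intro q hq
    have h1 : (1 : Fin 3) = Fin.succ 0 := rfl
    have h2 : (2 : Fin 3) = Fin.succ 1 := rfl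
    have h := congr_arg (finSuccEquiv K 2) hq
    simp only [map_add, map_mul, map_pow, h1, h2, finSuccEquiv_X_zero, finSuccEquiv_X_succ, hC,
      map_zero] at h
    have hquad := Polynomial.exists_mul_sq_add_coeff_two_eq_zero
      (a := (C A * X 0 + C E * X 1 ^ 2 : MvPolynomial (Fin 2) K))
      (b := C A * X 0 ^ 2 + C B * X 1)
      (c := Polynomial.C (C E * X 0 ^ 2 + X 1) * Polynomial.X ^ 2 +
        Polynomial.C (C B * X 0 + X 1 ^ 2) * Polynomial.X + Polynomial.C 0)
      (q := finSuccEquiv K 2 q)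
      (irreducible_C_mul_X_add_C_mul_X_sq hA E (by decide)).ne_zero
      Polynomial.natDegree_quadratic_le (by
        rw [← h]
        simp only [Polynomial.C_add, Polynomial.C_mul, Polynomial.C_pow, Polynomial.C_0]
        ring)
    obtain ⟨r, hr⟩ := hquad
    rw [Polynomial.coeff_two_quadratic] at hr
    have hev := congr_arg (eval ![z, w]) hr
    simp [hzw, hzw'] at hev
end
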